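/- arXiv:2507.15751 — 2 statements merged into one kernel-verified Lean document; each statement's English description precedes it below -/
import Mathlib

section
/- Define r(x) = (√(33x² + 12x + 4) − 3x − 2)/(24x²) for x > 0 (so that 24x²r(x)² + 6x·r(x) + 4r(x) − 1 = 0), and set μ(x) = −x·(d/dx) ln r(x), σ²(x) = x·μ'(x). Then μ(1) = 5/7 and σ²(1) = 78/343. -/
open Filter Topology in
/-- With `r(x) = (√(33x²+12x+4) − 3x − 2)/(24x²)` (so `24x²r² + 6xr + 4r − 1 = 0`),
`μ(x) = -x (ln r)'(x)` and `σ²(x) = x μ'(x)` satisfy `μ(1) = 5/7` and `σ²(1) = 78/343`. -/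
theorem stmt_12 (r μ σ2 : ℝ → ℝ)
    (hr : ∀ x : ℝ, 0 < x →
      r x = (Real.sqrt (33 * x ^ 2 + 12 * x + 4) - 3 * x - 2) / (24 * x ^ 2))
    (hμ : ∀ x : ℝ, μ x = -x * deriv (fun t => Real.log (r t)) x)
    (hσ : ∀ x : ℝ, σ2 x = x * deriv μ x) :
    (∀ x : ℝ, 0 < x → 24 * x ^ 2 * (r x) ^ 2 + 6 * x * r x + 4 * r x - 1 = 0) ∧
    μ 1 = 5 / 7 ∧ σ2 1 = 78 / 343 := by
  have sq_sqrt (x : ℝ) (hx : 0 < x) :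
      Real.sqrt (33 * x ^ 2 + 12 * x + 4) ^ 2 = 33 * x ^ 2 + 12 * x + 4 :=
    Real.sq_sqrt (by positivity)
  have sqrt_deriv (x : ℝ) (hx : 0 < x) :
      HasDerivAt (fun t : ℝ => Real.sqrt (33 * t ^ 2 + 12 * t + 4))
        ((33 * x + 6) / Real.sqrt (33 * x ^ 2 + 12 * x + 4)) x := by
    have hpoly : HasDerivAt (fun t : ℝ => 33 * t ^ 2 + 12 * t + 4) (66 * x + 12) x := by
      refine ((((hasDerivAt_pow 2 x).const_mul 33).add
        ((hasDerivAt_id x).const_mul 12)).add_const 4).congr_deriv ?_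
      norm_num
      ring
    refine (hpoly.sqrt (by positivity)).congr_deriv ?_
    have hs : 0 < Real.sqrt (33 * x ^ 2 + 12 * x + 4) := by positivity
    field_simp
    ring
  have μ_eq (x : ℝ) (hx : 0 < x) : μ x = 1 - 2 / Real.sqrt (33 * x ^ 2 + 12 * x + 4) := by
    have hN : 0 < Real.sqrt (33 * x ^ 2 + 12 * x + 4) - 3 * x - 2 := by
      have : 3 * x + 2 < Real.sqrt (33 * x ^ 2 + 12 * x + 4) :=
        Real.lt_sqrt_of_sq_lt (by nlinarith [pow_pos hx 2])
      linarith
    have hlog : (fun t => Real.log (r t)) =ᶠ[𝓝 x] fun t =>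
        Real.log ((Real.sqrt (33 * t ^ 2 + 12 * t + 4) - 3 * t - 2) / (24 * t ^ 2)) := by
      filter_upwards [lt_mem_nhds hx] with t ht
      rw [hr t ht]
    have hden : HasDerivAt (fun t : ℝ => 24 * t ^ 2) (48 * x) x := by
      refine ((hasDerivAt_pow 2 x).const_mul 24).congr_deriv ?_
      norm_num
      ring
    have hnum : HasDerivAt (fun t : ℝ => Real.sqrt (33 * t ^ 2 + 12 * t + 4) - 3 * t - 2)
        ((33 * x + 6) / Real.sqrt (33 * x ^ 2 + 12 * x + 4) - 3) x := by
      refine (((sqrt_deriv x hx).sub ((hasDerivAt_id x).const_mul 3)).sub_const 2).congr_deriv ?_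
      ring
    have hderiv := (hnum.fun_div hden (by positivity)).log (by positivity)
    rw [hμ, hlog.deriv_eq, hderiv.deriv]
    have hs : 0 < Real.sqrt (33 * x ^ 2 + 12 * x + 4) := by positivity
    have hsq := sq_sqrt x hx
    generalize Real.sqrt (33 * x ^ 2 + 12 * x + 4) = s at *
    rw [show -x * ((((33 * x + 6) / s - 3) * (24 * x ^ 2) - (s - 3 * x - 2) * (48 * x)) /
        (24 * x ^ 2) ^ 2 / ((s - 3 * x - 2) / (24 * x ^ 2))) =
        2 - x * ((33 * x + 6) / s - 3) / (s - 3 * x - 2) by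
      generalize s - 3 * x - 2 = N at *
      field_simp
      ring]
    rw [sub_eq_iff_eq_add, ← sub_eq_iff_eq_add', eq_div_iff hN.ne']
    field_simp
    linear_combination hsq
  have sqrt_one : Real.sqrt (33 * 1 ^ 2 + 12 * 1 + 4) = 7 := by
    rw [Real.sqrt_eq_iff_mul_self_eq] <;> norm_num
  refine ⟨fun x hx => ?_, ?_, ?_⟩
  · rw [hr x hx]
    have hsq := sq_sqrt x hx
    generalize Real.sqrt (33 * x ^ 2 + 12 * x + 4) = s at *
    field_simp
    linear_combination hsq
  · rw [μ_eq 1 one_pos, sqrt_one]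
    norm_num
  · have hev : μ =ᶠ[𝓝 1] fun t => 1 - 2 / Real.sqrt (33 * t ^ 2 + 12 * t + 4) := by
      filter_upwards [lt_mem_nhds one_pos] with t ht
      exact μ_eq t ht
    have hderiv := ((hasDerivAt_const (1 : ℝ) (2 : ℝ)).fun_div (sqrt_deriv 1 one_pos)
      (by positivity)).const_sub 1
    rw [hσ, hev.deriv_eq, hderiv.deriv, sqrt_one]
    norm_num
end

section
/- The 10×10 stochastic matrix (1/12)M(1), where M(1) is the transfer matrix of the Euler-genus distribution of double-edge cycle graphs evaluated at x = 1 (explicitly given by rows: (4,8,0,0,0,0,0,0,0,0), (6,6,0,0,0,0,0,0,0,0), (0,0,4,8,0,0,0,0,0,0), (0,0,6,6,0,0,0,0,0,0), (2,2,0,0,2,0,6,0,0,0), (0,0,0,0,4,0,4,0,0,4), (0,0,0,0,6,0,6,0,0,0), (0,0,2,2,0,0,0,2,6,0), (0,0,0,0,0,0,0,6,6,0), (0,0,0,0,0,2,0,4,4,2), each divided by 12), has eigenvalue 1 with algebraic multiplicity 2; in particular it is not a primitive matrix. -/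
open Matrix

/-- The transfer matrix of the Euler-genus distribution of double-edge cycle graphs at `x = 1`. -/
def doubleCycleTransfer : Matrix (Fin 10) (Fin 10) ℝ :=
  !![4,8,0,0,0,0,0,0,0,0;
     6,6,0,0,0,0,0,0,0,0;
     0,0,4,8,0,0,0,0,0,0;
     0,0,6,6,0,0,0,0,0,0;
     2,2,0,0,2,0,6,0,0,0;
     0,0,0,0,4,0,4,0,0,4;
     0,0,0,0,6,0,6,0,0,0;
     0,0,2,2,0,0,0,2,6,0;
     0,0,0,0,0,0,0,6,6,0;
     0,0,0,0,0,2,0,4,4,2]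

namespace Matrix

theorem charpoly_toSquareBlock_of_fiber_pair {n α R : Type*} [Fintype n] [DecidableEq n]
    [DecidableEq α] [CommRing R] [Nontrivial R] (M : Matrix n n R) (b : n → α) (a : α) (i j : n)
    (hij : i ≠ j) (h : ∀ k, b k = a ↔ k = i ∨ k = j) :
    (M.toSquareBlock b a).charpoly =
      Polynomial.X ^ 2 - Polynomial.C (M i i + M j j) * Polynomial.X +
        Polynomial.C (M i i * M j j - M i j * M j i) := by
  have hi : b i = a := (h i).2 (Or.inl rfl)
  have hj : b j = a := (h j).2 (Or.inr rfl)
  let f : Fin 2 → {k // b k = a} := ![⟨i, hi⟩, ⟨j, hj⟩]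
  have hf : Function.Bijective f := by
    refine ⟨fun x y hxy => ?_, fun ⟨k, hk⟩ => ?_⟩
    · fin_cases x <;> fin_cases y <;> simp_all [f, hij.symm]
    · rcases (h k).1 hk with rfl | rfl
      · exact ⟨0, rfl⟩
      · exact ⟨1, rfl⟩
  rw [← charpoly_reindex (Equiv.ofBijective f hf).symm, charpoly_fin_two, trace_fin_two,
    det_fin_two]
  simp [f, toSquareBlock_def]

end Matrix

/-- The level of each state in an ordering of the communicating classes of the transfer matrix;
the two closed classes `{0, 1}` and `{2, 3}` come last. -/
def doubleCycleLevel : Fin 10 → Fin 5 := ![4, 4, 3, 3, 2, 0, 2, 1, 1, 0]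

theorem doubleCycleTransfer_blockTriangular :
    ((12 : ℝ)⁻¹ • doubleCycleTransfer).BlockTriangular doubleCycleLevel := by
  intro i j
  fin_cases i <;> fin_cases j <;>
    simp [doubleCycleLevel, doubleCycleTransfer]

open Polynomial in
theorem doubleCycleTransfer_charpoly :
    ((12 : ℝ)⁻¹ • doubleCycleTransfer).charpoly =
      ((X + C (1 / 6)) ^ 2 * (X ^ 2 - C (2 / 3) * X - C (1 / 6)) ^ 2 *
        (X ^ 2 - C (1 / 6) * X - C (1 / 18))) * (X - C 1) ^ 2 := by
  have himage : Finset.univ.image doubleCycleLevel = Finset.univ := by decide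
  rw [doubleCycleTransfer_blockTriangular.charpoly, himage]
  simp only [Fin.prod_univ_five]
  rw [charpoly_toSquareBlock_of_fiber_pair _ _ 0 5 9 (by decide) (by decide),
    charpoly_toSquareBlock_of_fiber_pair _ _ 1 7 8 (by decide) (by decide),
    charpoly_toSquareBlock_of_fiber_pair _ _ 2 4 6 (by decide) (by decide),
    charpoly_toSquareBlock_of_fiber_pair _ _ 3 2 3 (by decide) (by decide),
    charpoly_toSquareBlock_of_fiber_pair _ _ 4 0 1 (by decide) (by decide)]
  refine Polynomial.funext fun x => ?_
  simp [doubleCycleTransfer]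
  ring

/-- The stochastic matrix `(1/12)M(1)` has eigenvalue `1` with algebraic multiplicity `2`;
in particular it is not primitive. -/
theorem stmt_15 :
    ((Matrix.charpoly ((12 : ℝ)⁻¹ • doubleCycleTransfer)).rootMultiplicity 1 = 2) ∧
    ¬ ∃ n : ℕ, 1 ≤ n ∧ ∀ i j : Fin 10,
        0 < (((12 : ℝ)⁻¹ • doubleCycleTransfer) ^ n) i j := by
  constructor
  · rw [doubleCycleTransfer_charpoly, Polynomial.rootMultiplicity_mul_X_sub_C_pow,
      Polynomial.rootMultiplicity_eq_zero]
    · norm_num [Polynomial.IsRoot]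
    · intro h
      have := congrArg (Polynomial.eval 1) h
      norm_num at this
  · rintro ⟨n, -, h⟩
    have hlevel : doubleCycleLevel 2 < doubleCycleLevel 0 := by decide
    exact (h 0 2).ne' (doubleCycleTransfer_blockTriangular.pow n hlevel)
end
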